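/- arXiv:2410.20226 — 2 statements merged into one kernel-verified Lean document; each statement's English description precedes it below -/
import Mathlib

section
/- For every integer α > 1, the subdigraph H_α of an almost Moore digraph G of degree d > 1 and diameter k > 1 is (r,k)-closed; that is, for any two distinct vertices u, v of H_α every walk of length at most k in G from u to v has all its vertices in H_α, and r(H_α) ⊆ H_α. -/
/-- `IsWalkFrom A u v l` : the list `u :: l` is a directed walk from `u` to `v`
along the adjacency relation `A`; the length of the walk is `l.length`. -/
def IsWalkFrom {V : Type} (A : V → V → Prop) (u v : V) (l : List V) : Prop :=
  List.Chain A u l ∧ (u :: l).getLast (List.cons_ne_nil u l) = v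

/-- An almost Moore digraph (a `(d,k)`-digraph): a diregular digraph of degree `d > 1`,
diameter `k > 1` and order `d + d² + ⋯ + d^k`, together with its repeat permutation `rep`:
for every vertex `v`, every vertex `w ≠ rep v` is reached from `v` by exactly one walk of
length at most `k`, while `rep v` is reached by exactly two such walks, at least one of
which has length `k`.  The map `rep` is an automorphism of the digraph. -/
structure AlmostMooreDigraph (d k : ℕ) where
  hd : 1 < d
  hk : 1 < k
  V : Type
  [fintypeV : Fintype V]
  [decEqV : DecidableEq V]
  Adj : V → V → Prop
  [adjDec : DecidableRel Adj]
  loopless : ∀ v, ¬ Adj v v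
  out_deg : ∀ v, {w | Adj v w}.ncard = d
  in_deg : ∀ v, {w | Adj w v}.ncard = d
  reach : ∀ u v, ∃ l, IsWalkFrom Adj u v l ∧ l.length ≤ k
  diam : ∃ u v, ∀ l, IsWalkFrom Adj u v l → k ≤ l.length
  card_eq : Fintype.card V = ∑ i ∈ Finset.range k, d ^ (i + 1)
  rep : V → V
  rep_spec : ∀ v w, w ≠ rep v → ∃! l, IsWalkFrom Adj v w l ∧ l.length ≤ k
  rep_two : ∀ v, ∃ l₁ l₂, l₁ ≠ l₂ ∧
      IsWalkFrom Adj v (rep v) l₁ ∧ l₁.length ≤ k ∧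
      IsWalkFrom Adj v (rep v) l₂ ∧ l₂.length ≤ k ∧
      (l₁.length = k ∨ l₂.length = k) ∧
      (∀ l, IsWalkFrom Adj v (rep v) l → l.length ≤ k → l = l₁ ∨ l = l₂)
  rep_bijective : Function.Bijective rep
  rep_adj : ∀ u v, Adj u v ↔ Adj (rep u) (rep v)

attribute [instance] AlmostMooreDigraph.fintypeV AlmostMooreDigraph.decEqV
  AlmostMooreDigraph.adjDec

/-- `ordRep M v` : the smallest `t ≥ 1` with `rep^t v = v`. -/
noncomputable def ordRep {d k : ℕ} (M : AlmostMooreDigraph d k) (v : M.V) : ℕ :=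
  sInf {t | 0 < t ∧ M.rep^[t] v = v}

/-- The vertex set of the subdigraph `H_α`: vertices whose order under the repeat
permutation divides `2^t * α` for some `t ≥ 0`. -/
def Hset {d k : ℕ} (M : AlmostMooreDigraph d k) (α : ℕ) : Set M.V :=
  {v | ∃ t : ℕ, ordRep M v ∣ 2 ^ t * α}

theorem ordRep_eq_minimalPeriod {d k : ℕ} (M : AlmostMooreDigraph d k) (v : M.V) :
    ordRep M v = Function.minimalPeriod M.rep v := by
  have hper : v ∈ Function.periodicPts M.rep :=
    M.rep_bijective.injective.mem_periodicPts v
  have hmem : Function.minimalPeriod M.rep v ∈ {t | 0 < t ∧ M.rep^[t] v = v} :=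
    ⟨Function.minimalPeriod_pos_of_mem_periodicPts hper, Function.iterate_minimalPeriod⟩
  obtain ⟨hpos, hfix⟩ := Nat.sInf_mem ⟨_, hmem⟩
  exact le_antisymm (Nat.sInf_le hmem) (Function.IsPeriodicPt.minimalPeriod_le hpos hfix)

theorem ordRep_dvd_iff {d k : ℕ} (M : AlmostMooreDigraph d k) (v : M.V) (n : ℕ) :
    ordRep M v ∣ n ↔ M.rep^[n] v = v := by
  rw [ordRep_eq_minimalPeriod, ← Function.isPeriodicPt_iff_minimalPeriod_dvd]
  rfl

theorem mem_Hset_iff {d k : ℕ} (M : AlmostMooreDigraph d k) (α : ℕ) (v : M.V) :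
    v ∈ Hset M α ↔ ∃ t : ℕ, M.rep^[2 ^ t * α] v = v :=
  exists_congr fun _ => ordRep_dvd_iff M v _

theorem IsWalkFrom.map {V : Type} {A : V → V → Prop} {f : V → V}
    (hf : ∀ a b, A a b → A (f a) (f b)) {u v : V} {l : List V} (h : IsWalkFrom A u v l) :
    IsWalkFrom A (f u) (f v) (l.map f) := by
  obtain ⟨hchain, rfl⟩ := h
  exact ⟨List.isChain_map_of_isChain (l := u :: l) f hf hchain,
    List.getLast_map (f := f) (l := u :: l) (by simp)⟩

theorem AlmostMooreDigraph.adj_iterate_rep {d k : ℕ} (M : AlmostMooreDigraph d k) (n : ℕ)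
    (a b : M.V) (h : M.Adj a b) : M.Adj (M.rep^[n] a) (M.rep^[n] b) := by
  induction n with
  | zero => exact h
  | succ n ih =>
    rw [Function.iterate_succ_apply', Function.iterate_succ_apply']
    exact (M.rep_adj _ _).1 ih

/-- Among any three short walks with the same ends, two coincide. -/
theorem AlmostMooreDigraph.eq_or_eq_or_eq_of_isWalkFrom {d k : ℕ} (M : AlmostMooreDigraph d k)
    {u v : M.V} {l₁ l₂ l₃ : List M.V}
    (h₁ : IsWalkFrom M.Adj u v l₁) (hk₁ : l₁.length ≤ k)
    (h₂ : IsWalkFrom M.Adj u v l₂) (hk₂ : l₂.length ≤ k)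
    (h₃ : IsWalkFrom M.Adj u v l₃) (hk₃ : l₃.length ≤ k) :
    l₁ = l₂ ∨ l₂ = l₃ ∨ l₁ = l₃ := by
  by_cases hv : v = M.rep u
  · subst hv
    obtain ⟨p, q, -, -, -, -, -, -, hpq⟩ := M.rep_two u
    rcases hpq l₁ h₁ hk₁ with rfl | rfl <;> rcases hpq l₂ h₂ hk₂ with rfl | rfl <;>
      rcases hpq l₃ h₃ hk₃ with rfl | rfl <;> simp
  · exact Or.inl ((M.rep_spec u v hv).unique ⟨h₁, hk₁⟩ ⟨h₂, hk₂⟩)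

/-- If an iterate of `rep` fixes both ends of a short walk, its square fixes the whole walk. -/
theorem AlmostMooreDigraph.iterate_rep_two_mul_of_mem {d k : ℕ} (M : AlmostMooreDigraph d k)
    {u v : M.V} {n : ℕ} (hu : M.rep^[n] u = u) (hv : M.rep^[n] v = v) {l : List M.V}
    (h : IsWalkFrom M.Adj u v l) (hl : l.length ≤ k) {w : M.V} (hw : w ∈ l) :
    M.rep^[2 * n] w = w := by
  have hmap {p : List M.V} (hp : IsWalkFrom M.Adj u v p) :
      IsWalkFrom M.Adj u v (p.map M.rep^[n]) := by
    simpa only [hu, hv] using hp.map (M.adj_iterate_rep n)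
  have hinj : Function.Injective (List.map M.rep^[n]) :=
    List.map_injective_iff.2 (M.rep_bijective.injective.iterate n)
  have hfix : (l.map M.rep^[n]).map M.rep^[n] = l := by
    rcases M.eq_or_eq_or_eq_of_isWalkFrom h hl (hmap h) (by simpa using hl)
      (hmap (hmap h)) (by simpa using hl) with h₁ | h₂ | h₃
    · rw [← h₁, ← h₁]
    · have h₁ := hinj h₂
      rw [← h₁, ← h₁]
    · exact h₃.symm
  rw [two_mul, Function.iterate_add_apply]
  rw [List.map_map] at hfix
  exact List.map_inj_left.1 (hfix.trans l.map_id.symm) w hw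


/-- For every integer `α > 1`, the subdigraph `H_α` of an almost Moore
digraph is `(r,k)`-closed: for any two distinct vertices `u, v` of `H_α`, every walk of
length at most `k` in `G` from `u` to `v` has all its vertices in `H_α`, and
`r(H_α) ⊆ H_α`. -/
theorem stmt1 {d k : ℕ} (M : AlmostMooreDigraph d k) (α : ℕ) (hα : 1 < α) :
    (∀ u v : M.V, u ∈ Hset M α → v ∈ Hset M α → u ≠ v →
      ∀ l : List M.V, IsWalkFrom M.Adj u v l → l.length ≤ k →
        ∀ w ∈ u :: l, w ∈ Hset M α) ∧
    (∀ v ∈ Hset M α, M.rep v ∈ Hset M α) := by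
  have hiter {v : M.V} {t : ℕ} (h : M.rep^[2 ^ t * α] v = v) (s : ℕ) :
      M.rep^[2 ^ (s + t) * α] v = v := by
    rw [← ordRep_dvd_iff] at h ⊢
    exact h.trans (Nat.mul_dvd_mul_right (pow_dvd_pow 2 (Nat.le_add_left t s)) α)
  refine ⟨fun u v hu hv _ l h hl w hw => ?_, fun v hv => ?_⟩
  · rcases List.mem_cons.1 hw with rfl | hw
    · exact hu
    obtain ⟨s, hs⟩ := (mem_Hset_iff M α u).1 hu
    obtain ⟨t, ht⟩ := (mem_Hset_iff M α v).1 hv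
    have hs' := hiter hs t
    rw [add_comm] at hs'
    refine (mem_Hset_iff M α w).2 ⟨s + t + 1, ?_⟩
    rw [pow_succ', mul_assoc]
    exact M.iterate_rep_two_mul_of_mem hs' (hiter ht s) h hl hw
  · obtain ⟨t, ht⟩ := (mem_Hset_iff M α v).1 hv
    refine (mem_Hset_iff M α _).2 ⟨t, ?_⟩
    rw [← Function.iterate_succ_apply, Function.iterate_succ_apply', ht]
end

section
/- Let G be an almost Moore digraph of degree d > 1 and diameter k > 1 and let α > 1 be an integer. If the subdigraph H_α is different from the directed k-cycle C_k, then H_α is itself an almost Moore digraph of some degree d' ≤ d and the same diameter k; in particular H_α is diregular of degree d', has diameter k, and has order d' + d'² + ⋯ + d'^k. -/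
theorem Set.ncard_and_eq_sum_subtype {V : Type} [Fintype V] (p q : V → Prop)
    [Fintype (Subtype p)] [DecidablePred q] :
    {w | p w ∧ q w}.ncard = ∑ w : Subtype p, if q w then 1 else 0 := by
  classical
  rw [← Finset.sum_subtype (Finset.univ.filter p) (by simp) (fun w => if q w then 1 else 0),
    Set.ncard_eq_toFinset_card']
  simp [Finset.filter_filter]

section Matrices

variable {W : Type} [Fintype W] [DecidableEq W]

theorem Matrix.sum_row_pow (B : Matrix W W ℕ) (c : ℕ) (h : ∀ u, ∑ w, B u w = c) (i : ℕ) (u : W) :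
    ∑ w, (B ^ i) u w = c ^ i := by
  induction i generalizing u with
  | zero => simp [Matrix.one_apply]
  | succ i ih =>
    simp only [pow_succ' B, Matrix.mul_apply]
    rw [Finset.sum_comm]
    simp only [← Finset.mul_sum, ih, ← Finset.sum_mul, h]
    rw [pow_succ']

theorem Matrix.pow_apply_perm (B : Matrix W W ℕ) (e : Equiv.Perm W)
    (h : ∀ u v, B (e u) (e v) = B u v) (i : ℕ) (u v : W) : (B ^ i) (e u) (e v) = (B ^ i) u v := by
  induction i generalizing u with
  | zero => simp [Matrix.one_apply]
  | succ i ih =>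
    simp only [pow_succ' B, Matrix.mul_apply]
    rw [← Equiv.sum_comp e]
    simp only [h, ih]

/-- If `I + B + ⋯ + B^k = J + P`, where `P` is the matrix of an automorphism of `B`, then all row
sums and all column sums of `B` agree. -/
theorem Matrix.row_sum_eq_col_sum (B : Matrix W W ℕ) (σ : Equiv.Perm W) (k : ℕ)
    (hB : ∀ u v, B (σ u) (σ v) = B u v)
    (hS : ∀ u v, ∑ i ∈ Finset.range (k + 1), (B ^ i) u v = 1 + if v = σ u then 1 else 0)
    (u v : W) : ∑ w, B u w = ∑ w, B w v := by
  obtain ⟨v, rfl⟩ := σ.surjective v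
  have hS' : ∀ u v, (∑ i ∈ Finset.range (k + 1), B ^ i) u v = 1 + if v = σ u then 1 else 0 := by
    intro u v
    rw [Matrix.sum_apply, hS]
  have hcomm : Commute B (∑ i ∈ Finset.range (k + 1), B ^ i) :=
    Commute.sum_right _ _ _ fun i _ => Commute.self_pow B i
  have h := congrFun (congrFun hcomm.eq u) (σ v)
  simp only [Matrix.mul_apply, hS', mul_add, add_mul, mul_one, one_mul, Finset.sum_add_distrib,
    σ.injective.eq_iff, mul_ite, ite_mul, mul_zero, zero_mul, Finset.sum_ite_eq,
    Finset.sum_ite_eq', Finset.mem_univ, if_true, hB] at h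
  exact Nat.add_right_cancel h

/-- A loopless solution of `I + B + ⋯ + B^k = J + P` of degree one has only self-repeats. -/
theorem Matrix.perm_eq_self_of_row_sum_eq_one (B : Matrix W W ℕ) (σ : Equiv.Perm W) (k : ℕ)
    (hloop : ∀ u, B u u = 0)
    (hS : ∀ u v, ∑ i ∈ Finset.range (k + 1), (B ^ i) u v = 1 + if v = σ u then 1 else 0)
    (hone : ∀ u, ∑ w, B u w = 1) (v : W) : σ v = v := by
  by_contra hv
  have hS' : ∀ u v, (∑ i ∈ Finset.range (k + 1), B ^ i) u v = 1 + if v = σ u then 1 else 0 := by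
    intro u v
    rw [Matrix.sum_apply, hS]
  have hgeom : B * (∑ i ∈ Finset.range (k + 1), B ^ i) + 1
      = (∑ i ∈ Finset.range (k + 1), B ^ i) + B ^ (k + 1) := by
    rw [← Finset.sum_range_succ, Finset.sum_range_succ' _ (k + 1), Finset.mul_sum, pow_zero]
    simp only [pow_succ' B]
  have h := congrFun (congrFun hgeom v) (σ v)
  simp only [Matrix.add_apply, Matrix.mul_apply, hS', mul_add, mul_one, Finset.sum_add_distrib,
    σ.injective.eq_iff, mul_ite, mul_zero, Finset.sum_ite_eq, Finset.mem_univ, if_true, hone,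
    hloop, Matrix.one_apply, if_neg (Ne.symm hv)] at h
  omega

/-- If `e` is an automorphism of `A` such that `e` and `e²` have the same fixed points and
`(A^i) u v ≤ 2`, then every walk of length `i` between fixed points of `e` has its second vertex
fixed by `e`. -/
theorem Matrix.mul_pow_apply_eq_zero (A : Matrix W W ℕ) (e : Equiv.Perm W)
    (hA : ∀ u v, A (e u) (e v) = A u v) (he : ∀ w, e (e w) = w → e w = w) (i : ℕ) {u v : W}
    (hu : e u = u) (hv : e v = v) (hle : (A ^ (i + 1)) u v ≤ 2) {w : W} (hw : e w ≠ w) :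
    A u w * (A ^ i) w v = 0 := by
  by_contra hne
  have hshift : ∀ x, A u (e x) * (A ^ i) (e x) v = A u x * (A ^ i) x v := by
    intro x
    have h1 := hA u x
    have h2 := Matrix.pow_apply_perm A e hA i x v
    rw [hu] at h1
    rw [hv] at h2
    rw [h1, h2]
  have hsum : ∑ x ∈ ({w, e w, e (e w)} : Finset W), A u x * (A ^ i) x v ≤ (A ^ (i + 1)) u v := by
    rw [pow_succ' A, Matrix.mul_apply]
    exact Finset.sum_le_sum_of_subset (Finset.subset_univ _)
  have h1 : w ∉ ({e w, e (e w)} : Finset W) := by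
    simp only [Finset.mem_insert, Finset.mem_singleton, not_or]
    exact ⟨fun h => hw h.symm, fun h => hw (he w h.symm)⟩
  have h2 : e w ∉ ({e (e w)} : Finset W) := by
    simp only [Finset.mem_singleton, e.injective.eq_iff]
    exact fun h => hw h.symm
  rw [Finset.sum_insert h1, Finset.sum_insert h2, Finset.sum_singleton,
    hshift (e w), hshift w] at hsum
  omega

/-- If short walks between elements of a set stay in the set, powers of the restricted matrix are
restrictions of powers. -/
theorem Matrix.submatrix_val_pow_apply (A : Matrix W W ℕ) (p : W → Prop) [Fintype (Subtype p)]
    [DecidableEq (Subtype p)] (k : ℕ)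
    (h : ∀ i < k, ∀ u v, p u → p v → ∀ w, ¬ p w → A u w * (A ^ i) w v = 0) (i : ℕ) (hi : i ≤ k)
    (u v : Subtype p) :
    ((A.submatrix Subtype.val Subtype.val : Matrix (Subtype p) (Subtype p) ℕ) ^ i) u v
      = (A ^ i) u v := by
  classical
  induction i generalizing u with
  | zero => simp [Matrix.one_apply, Subtype.ext_iff]
  | succ i ih =>
    simp only [pow_succ', Matrix.mul_apply, Matrix.submatrix_apply, ih (by omega)]
    rw [← Finset.sum_filter_of_ne (p := p) (s := Finset.univ)
      (f := fun w => A u w * (A ^ i) w v)]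
    · exact (Finset.sum_subtype (Finset.univ.filter p) (by simp)
        (fun w => A u w * (A ^ i) w v)).symm
    · intro w _ hw
      by_contra hp
      exact hw (h i hi u v u.2 v.2 w hp)

end Matrices

section Walks

theorem isWalkFrom_nil {V : Type} {R : V → V → Prop} {u v : V} : IsWalkFrom R u v [] ↔ u = v := by
  simp [IsWalkFrom, List.Chain]

theorem isWalkFrom_cons {V : Type} {R : V → V → Prop} {u v w : V}
    {l : List V} :
    IsWalkFrom R u v (w :: l) ↔ R u w ∧ IsWalkFrom R w v l := by
  simp [IsWalkFrom, List.Chain, List.isChain_cons_cons, and_assoc]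

variable {V : Type} [Fintype V] [DecidableEq V] (R : V → V → Prop) [DecidableRel R]

/-- The adjacency matrix of a relation. -/
def relMatrix : Matrix V V ℕ := Matrix.of fun u v => if R u v then 1 else 0

variable {R}

theorem relMatrix_mul_pow_apply_le (i : ℕ) (u v w : V) :
    relMatrix R u w * (relMatrix R ^ i) w v ≤ (relMatrix R ^ (i + 1)) u v := by
  rw [pow_succ', Matrix.mul_apply]
  exact Finset.single_le_sum (f := fun w => relMatrix R u w * (relMatrix R ^ i) w v)
    (fun _ _ => Nat.zero_le _) (Finset.mem_univ w)

theorem IsWalkFrom.one_le_pow {u v : V} {l : List V} (h : IsWalkFrom R u v l) :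
    1 ≤ (relMatrix R ^ l.length) u v := by
  induction l generalizing u with
  | nil =>
    rw [isWalkFrom_nil] at h
    simp [h]
  | cons w l ih =>
    rw [isWalkFrom_cons] at h
    refine le_trans ?_ (relMatrix_mul_pow_apply_le l.length u v w)
    simpa [relMatrix, h.1] using ih h.2

theorem IsWalkFrom.two_le_pow {u v : V} {l₁ l₂ : List V} (h₁ : IsWalkFrom R u v l₁)
    (h₂ : IsWalkFrom R u v l₂) (hne : l₁ ≠ l₂) (hlen : l₁.length = l₂.length) :
    2 ≤ (relMatrix R ^ l₁.length) u v := by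
  induction l₁ generalizing u l₂ with
  | nil => exact absurd (List.length_eq_zero_iff.1 hlen.symm).symm hne
  | cons w₁ l₁ ih =>
    cases l₂ with
    | nil => simp at hlen
    | cons w₂ l₂ =>
      rw [isWalkFrom_cons] at h₁ h₂
      have hlen' : l₁.length = l₂.length := by simpa using hlen
      by_cases hw : w₁ = w₂
      · subst hw
        refine le_trans ?_ (relMatrix_mul_pow_apply_le l₁.length u v w₁)
        simpa [relMatrix, h₁.1] using ih h₁.2 h₂.2 (by simpa using hne) hlen'
      · have h3 := h₁.2.one_le_pow
        have h4 := h₂.2.one_le_pow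
        rw [← hlen'] at h4
        rw [List.length_cons, pow_succ', Matrix.mul_apply]
        refine le_trans ?_ (Finset.add_le_sum
          (f := fun w => relMatrix R u w * (relMatrix R ^ l₁.length) w v)
          (fun _ _ => Nat.zero_le _) (Finset.mem_univ w₁) (Finset.mem_univ w₂) hw)
        have e1 : relMatrix R u w₁ = 1 := by simp [relMatrix, h₁.1]
        have e2 : relMatrix R u w₂ = 1 := by simp [relMatrix, h₂.1]
        simp only [e1, e2, one_mul]
        omega

theorem IsWalkFrom.one_le_sum_pow {u v : V} {l : List V} (h : IsWalkFrom R u v l) {k : ℕ}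
    (hk : l.length ≤ k) : 1 ≤ ∑ i ∈ Finset.range (k + 1), (relMatrix R ^ i) u v :=
  h.one_le_pow.trans (Finset.single_le_sum (f := fun i => (relMatrix R ^ i) u v)
    (fun _ _ => Nat.zero_le _) (Finset.mem_range.2 (by omega)))

theorem IsWalkFrom.two_le_sum_pow {u v : V} {l₁ l₂ : List V} (h₁ : IsWalkFrom R u v l₁)
    (h₂ : IsWalkFrom R u v l₂) (hne : l₁ ≠ l₂) {k : ℕ} (hk₁ : l₁.length ≤ k)
    (hk₂ : l₂.length ≤ k) : 2 ≤ ∑ i ∈ Finset.range (k + 1), (relMatrix R ^ i) u v := by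
  by_cases hlen : l₁.length = l₂.length
  · exact (h₁.two_le_pow h₂ hne hlen).trans
      (Finset.single_le_sum (f := fun i => (relMatrix R ^ i) u v)
        (fun _ _ => Nat.zero_le _) (Finset.mem_range.2 (by omega)))
  · refine le_trans ?_ (Finset.add_le_sum (f := fun i => (relMatrix R ^ i) u v)
      (fun _ _ => Nat.zero_le _) (Finset.mem_range.2 (Nat.lt_succ_of_le hk₁))
      (Finset.mem_range.2 (Nat.lt_succ_of_le hk₂)) hlen)
    have h3 := h₁.one_le_pow
    have h4 := h₂.one_le_pow
    exact Nat.add_le_add h3 h4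

/-- If short walks between elements of a set have their second vertex in the set, then they have
all their vertices in the set. -/
theorem IsWalkFrom.forall_mem {p : V → Prop} {k : ℕ}
    (hp : ∀ i < k, ∀ u v, p u → p v → ∀ w, ¬ p w →
      relMatrix R u w * (relMatrix R ^ i) w v = 0)
    {u v : V} {l : List V} (h : IsWalkFrom R u v l) (hl : l.length ≤ k) (hu : p u) (hv : p v) :
    ∀ w ∈ u :: l, p w := by
  induction l generalizing u with
  | nil => simpa using hu
  | cons w l ih =>
    rw [isWalkFrom_cons] at h
    rw [List.length_cons] at hl
    have hw : p w := by
      by_contra hw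
      have h0 := hp l.length hl u v hu hv w hw
      have h1 := h.2.one_le_pow
      have e1 : relMatrix R u w = 1 := by simp [relMatrix, h.1]
      rw [e1, one_mul] at h0
      omega
    have := ih h.2 (by omega) hw
    simpa [hu] using this

end Walks

namespace AlmostMooreDigraph

variable {d k : ℕ} (M : AlmostMooreDigraph d k)

/-- The repeat map as a permutation of the vertices. -/
noncomputable def repPerm : Equiv.Perm M.V := Equiv.ofBijective M.rep M.rep_bijective

theorem ordRep_dvd_iff (v : M.V) (n : ℕ) : ordRep M v ∣ n ↔ M.rep^[n] v = v := by
  have hper : v ∈ Function.periodicPts M.rep :=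
    M.rep_bijective.injective.mem_periodicPts v
  have hmem : Function.minimalPeriod M.rep v ∈ {t | 0 < t ∧ M.rep^[t] v = v} :=
    ⟨Function.minimalPeriod_pos_of_mem_periodicPts hper, Function.iterate_minimalPeriod⟩
  have hord : ordRep M v = Function.minimalPeriod M.rep v := by
    refine le_antisymm (Nat.sInf_le hmem) ?_
    have h := Nat.sInf_mem (s := {t | 0 < t ∧ M.rep^[t] v = v}) ⟨_, hmem⟩
    exact Function.IsPeriodicPt.minimalPeriod_le h.1 h.2
  rw [hord, ← Function.isPeriodicPt_iff_minimalPeriod_dvd]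
  rfl

/-- `H_α` is the common fixed point set of `r^m` and of `r^(2m)` for some `m`. -/
theorem exists_hset_iff (α : ℕ) : ∃ m : ℕ, ∀ v : M.V,
    (v ∈ Hset M α ↔ (M.repPerm ^ m) v = v) ∧
      ((M.repPerm ^ m) ((M.repPerm ^ m) v) = v → (M.repPerm ^ m) v = v) := by
  have hex : ∀ v : M.V, ∃ t : ℕ, v ∈ Hset M α → ordRep M v ∣ 2 ^ t * α := by
    intro v
    by_cases hv : v ∈ Hset M α
    · obtain ⟨t, ht⟩ := hv
      exact ⟨t, fun _ => ht⟩
    · exact ⟨0, fun h => absurd h hv⟩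
  choose t ht using hex
  set T := Finset.univ.sup t with hT
  have hpow : ∀ n v, (M.repPerm ^ n) v = v ↔ ordRep M v ∣ n := by
    intro n v
    rw [M.ordRep_dvd_iff, ← Equiv.Perm.iterate_eq_pow]
    rfl
  have hdvd : ∀ v ∈ Hset M α, ordRep M v ∣ 2 ^ T * α := fun v hv =>
    (ht v hv).trans (Nat.mul_dvd_mul_right
      (pow_dvd_pow 2 (Finset.le_sup (f := t) (Finset.mem_univ v))) α)
  refine ⟨2 ^ T * α, fun v => ⟨⟨fun hv => (hpow _ _).2 (hdvd v hv),
    fun hv => ⟨T, (hpow _ _).1 hv⟩⟩, fun hv => (hpow _ _).2 (hdvd v ⟨T + 1, ?_⟩)⟩⟩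
  rw [← Equiv.Perm.mul_apply, ← pow_add, hpow] at hv
  convert hv using 1
  ring

theorem relMatrix_rep (u v : M.V) :
    relMatrix M.Adj (M.repPerm u) (M.repPerm v) = relMatrix M.Adj u v := by
  have h : M.Adj (M.repPerm u) (M.repPerm v) ↔ M.Adj u v := (M.rep_adj u v).symm
  simp [relMatrix, h]

theorem relMatrix_rep_pow (m : ℕ) (u v : M.V) :
    relMatrix M.Adj ((M.repPerm ^ m) u) ((M.repPerm ^ m) v) = relMatrix M.Adj u v := by
  induction m with
  | zero => rfl
  | succ m ih =>
    rw [pow_succ', Equiv.Perm.mul_apply, Equiv.Perm.mul_apply, relMatrix_rep, ih]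

theorem sum_relMatrix (u : M.V) : ∑ w, relMatrix M.Adj u w = d := by
  refine Eq.trans ?_ (M.out_deg u)
  rw [Set.ncard_eq_toFinset_card']
  simp [relMatrix]

theorem sum_pow_relMatrix (u v : M.V) :
    ∑ i ∈ Finset.range (k + 1), (relMatrix M.Adj ^ i) u v
      = 1 + if v = M.repPerm u then 1 else 0 := by
  have hle : ∀ v ∈ Finset.univ, (1 + if v = M.repPerm u then 1 else 0)
      ≤ ∑ i ∈ Finset.range (k + 1), (relMatrix M.Adj ^ i) u v := by
    intro v _
    split_ifs with h
    · subst h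
      obtain ⟨l₁, l₂, hne, h₁, hk₁, h₂, hk₂, -⟩ := M.rep_two u
      exact h₁.two_le_sum_pow h₂ hne hk₁ hk₂
    · obtain ⟨l, hl, hlk⟩ := M.reach u v
      exact hl.one_le_sum_pow hlk
  refine ((Finset.sum_eq_sum_iff_of_le hle).1 ?_ v (Finset.mem_univ v)).symm
  rw [Finset.sum_comm]
  simp only [Matrix.sum_row_pow _ d M.sum_relMatrix, Finset.sum_add_distrib,
    Finset.sum_ite_eq', Finset.mem_univ, if_true, Finset.sum_const, Finset.card_univ, smul_eq_mul,
    mul_one, M.card_eq]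
  rw [Finset.sum_range_succ' _ k, pow_zero]

end AlmostMooreDigraph

/-- If the subdigraph `H_α` is different from the directed `k`-cycle
`C_k` (the set of self-repeats), then `H_α` is itself an almost Moore digraph of some
degree `d' ≤ d` and the same diameter `k`: it is diregular of degree `d'`, has diameter
exactly `k`, and has order `d' + d'² + ⋯ + d'^k`. -/
theorem stmt8 {d k : ℕ} (M : AlmostMooreDigraph d k) (α : ℕ) (hα : 1 < α)
    (hne : Hset M α ≠ {v | M.rep v = v}) :
    ∃ d' : ℕ, 1 < d' ∧ d' ≤ d ∧
      (∀ v ∈ Hset M α,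
        {w | w ∈ Hset M α ∧ M.Adj v w}.ncard = d' ∧
        {w | w ∈ Hset M α ∧ M.Adj w v}.ncard = d') ∧
      (∀ u ∈ Hset M α, ∀ v ∈ Hset M α,
        ∃ l : List M.V, IsWalkFrom M.Adj u v l ∧ l.length ≤ k ∧
          ∀ w ∈ u :: l, w ∈ Hset M α) ∧
      (∃ u ∈ Hset M α, ∃ v ∈ Hset M α,
        ∀ l : List M.V, IsWalkFrom M.Adj u v l → (∀ w ∈ u :: l, w ∈ Hset M α) →
          k ≤ l.length) ∧
      (Hset M α).ncard = ∑ i ∈ Finset.range k, d' ^ (i + 1) := by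
  classical
  obtain ⟨m, hm⟩ := M.exists_hset_iff α
  have hsub : ∀ v, M.rep v = v → v ∈ Hset M α := fun v hv =>
    ⟨0, (M.ordRep_dvd_iff v _).2 (Function.iterate_fixed hv _)⟩
  obtain ⟨v₀, hv₀, hrv₀⟩ : ∃ v ∈ Hset M α, M.rep v ≠ v := by
    by_contra! h
    exact hne (Set.Subset.antisymm h hsub)
  have hrep : ∀ v, M.repPerm v ∈ Hset M α ↔ v ∈ Hset M α := by
    intro v
    rw [(hm _).1, (hm v).1, ← Equiv.Perm.mul_apply, ← pow_succ, pow_succ', Equiv.Perm.mul_apply,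
      M.repPerm.injective.eq_iff]
  set σ : Equiv.Perm (Hset M α) := M.repPerm.subtypePerm hrep with hσ
  have hclosed : ∀ i < k, ∀ u v, u ∈ Hset M α → v ∈ Hset M α → ∀ w, ¬ w ∈ Hset M α →
      relMatrix M.Adj u w * (relMatrix M.Adj ^ i) w v = 0 := by
    intro i hi u v hu hv w hw
    refine Matrix.mul_pow_apply_eq_zero _ (M.repPerm ^ m) (M.relMatrix_rep_pow m)
      (fun w => (hm w).2) i ((hm u).1.1 hu) ((hm v).1.1 hv) ?_ (fun h => hw ((hm w).1.2 h))
    refine (Finset.single_le_sum (f := fun i => (relMatrix M.Adj ^ i) u v)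
      (fun _ _ => Nat.zero_le _) (Finset.mem_range.2 (by omega : i + 1 < k + 1))).trans ?_
    rw [M.sum_pow_relMatrix]
    split_ifs <;> omega
  set B : Matrix (Hset M α) (Hset M α) ℕ :=
    (relMatrix M.Adj).submatrix Subtype.val Subtype.val with hB
  have hBpow : ∀ i ≤ k, ∀ u v : Hset M α, (B ^ i) u v = (relMatrix M.Adj ^ i) u v :=
    Matrix.submatrix_val_pow_apply _ (· ∈ Hset M α) k hclosed
  have hS : ∀ u v, ∑ i ∈ Finset.range (k + 1), (B ^ i) u v = 1 + if v = σ u then 1 else 0 := by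
    intro u v
    rw [Finset.sum_congr rfl fun i hi => hBpow i (by simpa [Nat.lt_succ_iff] using hi) u v,
      M.sum_pow_relMatrix]
    simp [hσ, Subtype.ext_iff]
  have hreg := Matrix.row_sum_eq_col_sum B σ k (fun u v => M.relMatrix_rep u v) hS
  have hout : ∀ v : Hset M α, {w | w ∈ Hset M α ∧ M.Adj v w}.ncard = ∑ w, B v w := fun v =>
    Set.ncard_and_eq_sum_subtype (· ∈ Hset M α) (M.Adj v)
  have hin : ∀ v : Hset M α, {w | w ∈ Hset M α ∧ M.Adj w v}.ncard = ∑ w, B w v := fun v =>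
    Set.ncard_and_eq_sum_subtype (· ∈ Hset M α) (M.Adj · v)
  set d' := ∑ w, B ⟨v₀, hv₀⟩ w with hd'
  have hrow : ∀ u, ∑ w, B u w = d' := fun u => by rw [hreg u u, hd', hreg ⟨v₀, hv₀⟩ u]
  have hcol : ∀ u, ∑ w, B w u = d' := fun u => (hreg ⟨v₀, hv₀⟩ u).symm
  have hcard : (Hset M α).ncard = ∑ i ∈ Finset.range k, d' ^ (i + 1) := by
    have h : ∑ v, ∑ i ∈ Finset.range (k + 1), (B ^ i) ⟨v₀, hv₀⟩ v = Fintype.card (Hset M α) + 1 := by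
      simp [hS, Finset.sum_add_distrib]
    rw [Finset.sum_comm] at h
    simp only [Matrix.sum_row_pow B d' hrow] at h
    rw [Finset.sum_range_succ' _ k, pow_zero] at h
    rw [← Nat.card_coe_set_eq, Nat.card_eq_fintype_card]
    exact (Nat.add_right_cancel h).symm
  have hd1 : 1 < d' := by
    by_contra! hle
    have hd0 : d' = 0 ∨ d' = 1 := by omega
    rcases hd0 with h0 | h1
    · have : 0 < (Hset M α).ncard := (Set.ncard_pos (Set.toFinite _)).2 ⟨v₀, hv₀⟩
      rw [hcard, h0] at this
      simp at this
    · have h := Matrix.perm_eq_self_of_row_sum_eq_one B σ k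
        (fun u => by simp [hB, relMatrix, M.loopless]) hS (fun u => (hrow u).trans h1) ⟨v₀, hv₀⟩
      exact hrv₀ (congrArg Subtype.val h)
  refine ⟨d', hd1, ?_, fun v hv => ⟨(hout ⟨v, hv⟩).trans (hrow _), (hin ⟨v, hv⟩).trans (hcol _)⟩,
    ?_, ?_, hcard⟩
  · rw [hd', ← hout]
    exact (Set.ncard_le_ncard fun w hw => hw.2).trans_eq (M.out_deg v₀)
  · intro u hu v hv
    obtain ⟨l, hl, hlk⟩ := M.reach u v
    exact ⟨l, hl, hlk, hl.forall_mem (p := (· ∈ Hset M α)) hclosed hlk hu hv⟩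
  · refine ⟨v₀, hv₀, ?_⟩
    by_contra! h
    have hpos : ∀ v : Hset M α, 1 ≤ ∑ i ∈ Finset.range k, (B ^ i) ⟨v₀, hv₀⟩ v := by
      intro v
      obtain ⟨l, hl, -, hlk⟩ := h v v.2
      refine le_trans ?_ (Finset.single_le_sum (f := fun i => (B ^ i) ⟨v₀, hv₀⟩ v)
        (fun _ _ => Nat.zero_le _) (Finset.mem_range.2 hlk))
      simpa only [hBpow l.length hlk.le] using hl.one_le_pow
    have hsum := Finset.sum_le_sum fun v (_ : v ∈ Finset.univ) => hpos v
    rw [Finset.sum_comm] at hsum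
    simp only [Matrix.sum_row_pow B d' hrow, Finset.sum_const, Finset.card_univ, smul_eq_mul,
      mul_one] at hsum
    rw [← Nat.card_eq_fintype_card, Nat.card_coe_set_eq, hcard] at hsum
    have h1 : ∑ i ∈ Finset.range k, d' ^ (i + 1) + 1 = ∑ i ∈ Finset.range k, d' ^ i + d' ^ k := by
      rw [← Finset.sum_range_succ, Finset.sum_range_succ' _ k, pow_zero]
    have h2 : 1 < d' ^ k := Nat.one_lt_pow (by have := M.hk; omega) hd1
    omega
end
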